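/- arXiv:2310.17853 — 4 statements merged into one kernel-verified Lean document; each statement's English description precedes it below -/
import Mathlib

section
/- Let D = 1 + Σ_{k=1}^n α_kβ_k/(1−α_k) and η_i = β_i/((1−α_i)D) for i=1,…,n. Then 0 < η_i and |η| = Σ η_i < 1, and the type-(1) transition matrix satisfies the detailed balance (reversibility) condition K_n^{(1)}(x,y) W_n(y;N,η) = K_n^{(1)}(y,x) W_n(x;N,η) for all x,y ∈ X. -/
open Finset

/-- The set `X = {x ∈ ℕ^n : |x| ≤ N}`. -/
def XSet (n N : ℕ) : Finset (Fin n → ℕ) :=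
  (Fintype.piFinset fun _ : Fin n => Finset.range (N + 1)).filter fun x => ∑ i, x i ≤ N

/-- Binomial weight `W₁(x; y, α) = C(y,x) α^x (1-α)^{y-x}`. -/
noncomputable def W1 (x y : ℕ) (a : ℝ) : ℝ :=
  (y.choose x : ℝ) * a ^ x * (1 - a) ^ (y - x)

/-- Multinomial weight `W_n(x; M, β)`. -/
noncomputable def Wmult {n : ℕ} (x : Fin n → ℕ) (M : ℕ) (β : Fin n → ℝ) : ℝ :=
  ((M.factorial : ℝ) / (((∏ i, (x i).factorial) * (M - ∑ i, x i).factorial : ℕ) : ℝ)) *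
    (1 - ∑ i, β i) ^ (M - ∑ i, x i) * ∏ i, (β i) ^ (x i)

/-- Type-(1) Markov transition matrix. -/
noncomputable def K1 (n N : ℕ) (α β : Fin n → ℝ) (x y : Fin n → ℕ) : ℝ :=
  ∑ z ∈ Fintype.piFinset fun i => Finset.range (min (x i) (y i) + 1),
    Wmult (fun i => x i - z i) (N - ∑ i, z i) β * ∏ i, W1 (z i) (y i) (α i)

/-- Type-(2) Markov transition matrix. -/
noncomputable def K2 (n N : ℕ) (α β : Fin n → ℝ) (x y : Fin n → ℕ) : ℝ :=
  ∑ z ∈ Fintype.piFinset fun i => Finset.Icc (x i + (∑ j, y j) - N) (min (x i) (y i)),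
    Wmult (fun i => x i - z i) (N - ∑ j, y j) β * ∏ i, W1 (z i) (y i) (α i)

/-- Rahman (Aomoto–Gelfand hypergeometric) polynomial `P_m(x; u)`. -/
noncomputable def RahmanP (n N : ℕ) (u : Matrix (Fin n) (Fin n) ℝ) (m x : Fin n → ℕ) : ℝ :=
  ∑ c ∈ ((Fintype.piFinset fun _ : Fin n =>
        Fintype.piFinset fun _ : Fin n => Finset.range (N + 1)).filter
        fun c => ∑ i, ∑ j, c i j ≤ N),
    ((∏ i, (ascPochhammer ℝ (∑ j, c i j)).eval (-(x i : ℝ))) *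
        (∏ j, (ascPochhammer ℝ (∑ i, c i j)).eval (-(m j : ℝ))) /
        (ascPochhammer ℝ (∑ i, ∑ j, c i j)).eval (-(N : ℝ))) *
    ∏ i, ∏ j, u i j ^ (c i j) / ((c i j).factorial : ℝ)

/-- The multinomial weight with its coordinatewise factors collected in one product. -/
lemma Wmult_eq_mul_prod {n : ℕ} (x : Fin n → ℕ) (M : ℕ) (β : Fin n → ℝ) :
    Wmult x M β = (M.factorial : ℝ) / ((M - ∑ i, x i).factorial : ℝ) *
      (1 - ∑ i, β i) ^ (M - ∑ i, x i) * ∏ i, (β i) ^ (x i) / ((x i).factorial : ℝ) := by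
  unfold Wmult
  rw [Finset.prod_div_distrib]
  push_cast
  simp only [div_eq_mul_inv, mul_inv]
  ring

/-- Coordinatewise factor of the detailed balance identity: apart from `D⁻¹ ^ y`, the right-hand
side is symmetric in `x` and `y`. -/
lemma coordinate_weight_eq {a b D : ℝ} (ha : a < 1) {x y z : ℕ} (hy : z ≤ y) :
    b ^ (x - z) / ((x - z).factorial : ℝ) * W1 z y a *
        ((b / ((1 - a) * D)) ^ y / (y.factorial : ℝ)) =
      D⁻¹ ^ y * (b ^ (x - z) * b ^ (y - z) * (a * b / (1 - a)) ^ z /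
        ((x - z).factorial * (y - z).factorial * z.factorial : ℝ)) := by
  have h1 : (1 - a) ≠ 0 := by linarith
  unfold W1
  rw [Nat.cast_choose ℝ hy]
  obtain ⟨q, rfl⟩ := Nat.exists_eq_add_of_le hy
  have hf : ((z + q).factorial : ℝ) ≠ 0 := by positivity
  simp only [Nat.add_sub_cancel_left, div_pow, mul_pow, inv_pow, pow_add]
  field_simp

/-- The type-(1) kernel times the multinomial weight, in a form symmetric in `x` and `y`. -/
lemma K1_mul_Wmult {n N : ℕ} {α β η : Fin n → ℝ} {D : ℝ} (hα : ∀ i, α i < 1)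
    (hη : ∀ i, η i = β i / ((1 - α i) * D)) (hs : 1 - ∑ i, η i = (1 - ∑ i, β i) * D⁻¹)
    {x y : Fin n → ℕ} (hy : ∑ i, y i ≤ N) :
    K1 n N α β x y * Wmult y N η =
      ∑ z ∈ Fintype.piFinset fun i => Finset.range (min (x i) (y i) + 1),
        D⁻¹ ^ N * ((N - ∑ i, z i).factorial : ℝ) * (N.factorial : ℝ) /
          ((N - ∑ i, x i).factorial * (N - ∑ i, y i).factorial : ℝ) *
        ((1 - ∑ i, β i) ^ (N - ∑ i, x i) * (1 - ∑ i, β i) ^ (N - ∑ i, y i)) *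
        ∏ i, β i ^ (x i - z i) * β i ^ (y i - z i) * (α i * β i / (1 - α i)) ^ z i /
          ((x i - z i).factorial * (y i - z i).factorial * (z i).factorial : ℝ) := by
  unfold K1
  rw [Finset.sum_mul]
  refine Finset.sum_congr rfl fun z hz => ?_
  have hz' : ∀ i, z i ≤ x i ∧ z i ≤ y i := fun i => by
    have := Fintype.mem_piFinset.1 hz i
    rw [Finset.mem_range] at this
    omega
  have hsum : N - ∑ i, z i - ∑ i, (x i - z i) = N - ∑ i, x i := by
    have : ∑ i, (x i - z i) + ∑ i, z i = ∑ i, x i := by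
      rw [← Finset.sum_add_distrib]
      exact Finset.sum_congr rfl fun i _ => Nat.sub_add_cancel (hz' i).1
    omega
  have hprod := Finset.prod_congr (rfl : (Finset.univ : Finset (Fin n)) = _) fun i _ =>
    coordinate_weight_eq (b := β i) (D := D) (hα i) (x := x i) (hz' i).2
  simp only [← hη, Finset.prod_mul_distrib (s := Finset.univ) (f := fun i => D⁻¹ ^ y i),
    Finset.prod_pow_eq_pow_sum] at hprod
  rw [Finset.prod_mul_distrib, Finset.prod_mul_distrib] at hprod
  rw [Wmult_eq_mul_prod, Wmult_eq_mul_prod, hsum, hs, mul_pow,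
    ← Nat.sub_add_cancel hy, pow_add D⁻¹, Nat.sub_add_cancel hy]
  linear_combination ((N - ∑ i, z i).factorial : ℝ) / ((N - ∑ i, x i).factorial : ℝ) *
    (1 - ∑ i, β i) ^ (N - ∑ i, x i) * ((N.factorial : ℝ) / ((N - ∑ i, y i).factorial : ℝ)) *
    ((1 - ∑ i, β i) ^ (N - ∑ i, y i) * D⁻¹ ^ (N - ∑ i, y i)) * hprod

theorem stmt2 (n N : ℕ) (hn : 0 < n) (hN : 0 < N) (α β : Fin n → ℝ)
    (hα : ∀ i, 0 < α i ∧ α i < 1) (hβ : ∀ i, 0 < β i) (hβs : ∑ i, β i < 1)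
    (D : ℝ) (hD : D = 1 + ∑ k, α k * β k / (1 - α k))
    (η : Fin n → ℝ) (hη : ∀ i, η i = β i / ((1 - α i) * D)) :
    (∀ i, 0 < η i) ∧ (∑ i, η i) < 1 ∧
      ∀ x ∈ XSet n N, ∀ y ∈ XSet n N,
        K1 n N α β x y * Wmult y N η = K1 n N α β y x * Wmult x N η := by
  have hα' : ∀ i, 0 < 1 - α i := fun i => sub_pos.2 (hα i).2
  have hDpos : 0 < D := by
    rw [hD]
    have : 0 ≤ ∑ k, α k * β k / (1 - α k) := Finset.sum_nonneg fun k _ =>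
      (div_pos (mul_pos (hα k).1 (hβ k)) (hα' k)).le
    linarith
  have hs : 1 - ∑ i, η i = (1 - ∑ i, β i) * D⁻¹ := by
    have hDη : D * ∑ i, η i = ∑ i, α i * β i / (1 - α i) + ∑ i, β i := by
      rw [Finset.mul_sum, ← Finset.sum_add_distrib]
      refine Finset.sum_congr rfl fun i _ => ?_
      have := (hα' i).ne'
      rw [hη]
      field_simp
      ring
    rw [eq_mul_inv_iff_mul_eq₀ hDpos.ne']
    linear_combination hD - hDη
  refine ⟨fun i => ?_, ?_, fun x hx y hy => ?_⟩
  · rw [hη]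
    exact div_pos (hβ i) (mul_pos (hα' i) hDpos)
  · have : 0 < (1 - ∑ i, β i) * D⁻¹ := mul_pos (sub_pos.2 hβs) (inv_pos.2 hDpos)
    linarith
  · have hx' := (Finset.mem_filter.1 hx).2
    have hy' := (Finset.mem_filter.1 hy).2
    rw [K1_mul_Wmult (fun i => (hα i).2) hη hs hy',
      K1_mul_Wmult (fun i => (hα i).2) hη hs hx']
    simp only [min_comm (y _) (x _)]
    refine Finset.sum_congr rfl fun z _ => ?_
    congr 1
    · ring
    · exact Finset.prod_congr rfl fun i _ => by ring
end

section
/- Generating function of the Aomoto–Gelfand hypergeometric polynomials (Mizukawa): for any n×n real matrix u, any x ∈ X, and any t = (t_1,…,t_n) ∈ ℝ^n, one has (1 + |t|)^{N−|x|} · ∏_{i=1}^n (1 + Σ_{j=1}^n (1−u_{ij}) t_j)^{x_i} = Σ_{m ∈ X} (N!/(m_1!⋯m_n!(N−|m|)!)) P_m(x;u) ∏_{j=1}^n t_j^{m_j}, where |t| = t_1+⋯+t_n. -/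
open Finset

theorem ascPochhammer_eval_neg_natCast (a k : ℕ) :
    (ascPochhammer ℝ k).eval (-(a : ℝ)) = (-1) ^ k * (a.descFactorial k : ℝ) := by
  rw [ascPochhammer_eval_neg_eq_descPochhammer, descPochhammer_eval_eq_descFactorial]

/-- Multinomial expansion of `(a + ∑ j, f j) ^ y` over a box of exponents. -/
theorem add_sum_pow_eq_sum_box {n : ℕ} {y M : ℕ} (hy : y ≤ M) (a : ℝ) (f : Fin n → ℝ) :
    (a + ∑ j, f j) ^ y =
      ∑ k ∈ Fintype.piFinset fun _ : Fin n => Finset.range (M + 1),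
        (y.descFactorial (∑ j, k j) : ℝ) * a ^ (y - ∑ j, k j) *
          ∏ j, f j ^ k j / ((k j).factorial : ℝ) := by
  have hsub : (Fintype.piFinset fun _ : Fin n => Finset.range (M + 1)).filter
      (fun k => ∑ j, k j ∈ Finset.range (y + 1)) ⊆
      Fintype.piFinset fun _ : Fin n => Finset.range (M + 1) := Finset.filter_subset _ _
  rw [← Finset.sum_subset hsub]
  · rw [← Finset.sum_fiberwise_of_maps_to (t := Finset.range (y + 1))
      (g := fun k : Fin n → ℕ => ∑ j, k j) (fun k hk => (Finset.mem_filter.1 hk).2),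
      add_comm a, add_pow]
    refine Finset.sum_congr rfl fun p hp => ?_
    have hpy : p ≤ y := Nat.lt_succ_iff.1 (Finset.mem_range.1 hp)
    rw [Finset.sum_pow_eq_sum_piAntidiag, Finset.sum_mul, Finset.sum_mul]
    refine Finset.sum_congr ?_ fun k hk => ?_
    · ext k
      simp only [Finset.mem_piAntidiag, Finset.mem_filter, Fintype.mem_piFinset, Finset.mem_range]
      refine ⟨fun h => ?_, fun h => ⟨h.2, fun _ _ => Finset.mem_univ _⟩⟩
      have hkp : ∑ j, k j = p := h.1
      refine ⟨⟨fun j => ?_, by omega⟩, hkp⟩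
      have := Finset.single_le_sum (f := k) (fun i _ => Nat.zero_le _) (Finset.mem_univ j)
      omega
    · have hkp : ∑ j, k j = p := (Finset.mem_filter.1 hk).2
      have hm : ((∏ j, (k j).factorial : ℕ) : ℝ) * Nat.multinomial Finset.univ k
          = p.factorial := by
        rw [← hkp]; exact_mod_cast Nat.multinomial_spec Finset.univ k
      have hne : ((∏ j, (k j).factorial : ℕ) : ℝ) ≠ 0 :=
        Nat.cast_ne_zero.2 (Finset.prod_ne_zero_iff.2 fun j _ => Nat.factorial_ne_zero _)
      rw [hkp, Nat.descFactorial_eq_factorial_mul_choose, Finset.prod_div_distrib,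
        ← Nat.cast_prod, Nat.cast_mul, ← hm]
      field_simp
  · intro k hk hk'
    have : y < ∑ j, k j := by
      by_contra! h
      exact hk' (Finset.mem_filter.2 ⟨hk, Finset.mem_range.2 (by omega)⟩)
    simp [Nat.descFactorial_eq_zero_iff_lt.2 this]

theorem sum_multinomial_mul_descFactorial {n N : ℕ} (s : Fin n → ℕ) (hs : ∑ j, s j ≤ N)
    (t : Fin n → ℝ) :
    ∑ m ∈ XSet n N,
        ((N.factorial : ℝ) / (((∏ j, (m j).factorial) * (N - ∑ j, m j).factorial : ℕ) : ℝ)) *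
          ((∏ j, ((m j).descFactorial (s j) : ℝ)) / (N.descFactorial (∑ j, s j) : ℝ)) *
          ∏ j, t j ^ m j =
      (1 + ∑ j, t j) ^ (N - ∑ j, s j) * ∏ j, t j ^ s j := by
  rw [add_sum_pow_eq_sum_box (Nat.sub_le N (∑ j, s j)), Finset.sum_mul]
  symm
  refine Finset.sum_bij_ne_zero (fun k _ _ j => k j + s j) ?_ ?_ ?_ ?_
  · intro k _ h
    have hle : ∑ j, k j ≤ N - ∑ j, s j := by
      by_contra! hlt
      exact h (by simp [Nat.descFactorial_eq_zero_iff_lt.2 hlt])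
    have hsum : ∑ j, (k j + s j) ≤ N := by rw [Finset.sum_add_distrib]; omega
    simp only [XSet, Finset.mem_filter, Fintype.mem_piFinset, Finset.mem_range]
    refine ⟨fun j => ?_, hsum⟩
    have := Finset.single_le_sum (f := fun j => k j + s j) (fun i _ => Nat.zero_le _)
      (Finset.mem_univ j)
    omega
  · intro k _ _ k' _ _ h
    ext j
    have := congrFun h j
    omega
  · intro m hm h
    have hsm : ∀ j, s j ≤ m j := by
      by_contra! hlt
      obtain ⟨j, hj⟩ := hlt
      refine h ?_
      rw [Finset.prod_eq_zero (Finset.mem_univ j) (f := fun j => ((m j).descFactorial (s j) : ℝ))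
        (by simp [Nat.descFactorial_eq_zero_iff_lt.2 hj])]
      simp
    obtain ⟨k, rfl⟩ : ∃ k : Fin n → ℕ, m = fun j => k j + s j :=
      ⟨fun j => m j - s j, by ext j; have := hsm j; dsimp only; omega⟩
    simp only [XSet, Finset.mem_filter, Fintype.mem_piFinset, Finset.mem_range,
      Finset.sum_add_distrib] at hm
    refine ⟨k, ?_, ?_, rfl⟩
    · simp only [Fintype.mem_piFinset, Finset.mem_range]
      intro j
      have := hm.1 j
      omega
    · have hd : (N - ∑ j, s j).descFactorial (∑ j, k j) ≠ 0 := by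
        rw [Ne, Nat.descFactorial_eq_zero_iff_lt]
        omega
      have ht : ∏ j, t j ^ (k j + s j) ≠ 0 := right_ne_zero_of_mul h
      simp only [pow_add, Finset.prod_mul_distrib] at ht
      have hf : ∏ j, ((k j).factorial : ℝ) ≠ 0 :=
        Finset.prod_ne_zero_iff.2 fun j _ => Nat.cast_ne_zero.2 (Nat.factorial_ne_zero _)
      rw [Finset.prod_div_distrib, one_pow, mul_one]
      exact mul_ne_zero (mul_ne_zero (Nat.cast_ne_zero.2 hd)
        (div_ne_zero (left_ne_zero_of_mul ht) hf)) (right_ne_zero_of_mul ht)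
  · intro k _ h
    have hle : ∑ j, k j ≤ N - ∑ j, s j := by
      by_contra! hlt
      exact h (by simp [Nat.descFactorial_eq_zero_iff_lt.2 hlt])
    have hN : ((N - ∑ j, s j).factorial : ℝ) * N.descFactorial (∑ j, s j) = N.factorial := by
      exact_mod_cast Nat.factorial_mul_descFactorial hs
    have hk : ((N - ∑ j, s j - ∑ j, k j).factorial : ℝ) *
        (N - ∑ j, s j).descFactorial (∑ j, k j) = (N - ∑ j, s j).factorial := by
      exact_mod_cast Nat.factorial_mul_descFactorial hle
    have hm : (∏ j, ((k j).factorial : ℝ)) * ∏ j, ((k j + s j).descFactorial (s j) : ℝ) =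
        ∏ j, ((k j + s j).factorial : ℝ) := by
      rw [← Finset.prod_mul_distrib]
      refine Finset.prod_congr rfl fun j _ => ?_
      have := Nat.factorial_mul_descFactorial (Nat.le_add_left (s j) (k j))
      rw [Nat.add_sub_cancel] at this
      exact_mod_cast this
    have hf : ∏ j, ((k j).factorial : ℝ) ≠ 0 :=
      Finset.prod_ne_zero_iff.2 fun j _ => Nat.cast_ne_zero.2 (Nat.factorial_ne_zero _)
    have hf' : ∏ j, ((k j + s j).descFactorial (s j) : ℝ) ≠ 0 :=
      right_ne_zero_of_mul (hm ▸ Finset.prod_ne_zero_iff.2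
        fun j _ => Nat.cast_ne_zero.2 (Nat.factorial_ne_zero _))
    have hd : (N.descFactorial (∑ j, s j) : ℝ) ≠ 0 :=
      right_ne_zero_of_mul (hN ▸ Nat.cast_ne_zero.2 (Nat.factorial_ne_zero _))
    have hd' : ((N - ∑ j, s j - ∑ j, k j).factorial : ℝ) ≠ 0 :=
      Nat.cast_ne_zero.2 (Nat.factorial_ne_zero _)
    have hsub : N - (∑ j, k j + ∑ j, s j) = N - ∑ j, s j - ∑ j, k j := by omega
    simp only [Finset.sum_add_distrib, hsub, Nat.cast_mul, Nat.cast_prod, pow_add,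
      Finset.prod_mul_distrib, Finset.prod_div_distrib, one_pow, mul_one]
    rw [← hN, ← hk, ← hm]
    field_simp

/-- Expansion of the left-hand side of the generating function over the matrices `c`. -/
theorem pow_mul_prod_pow_eq_sum {n N : ℕ} (u : Matrix (Fin n) (Fin n) ℝ) (x : Fin n → ℕ)
    (hx : ∑ i, x i ≤ N) (T : ℝ) (t : Fin n → ℝ) :
    T ^ (N - ∑ i, x i) * ∏ i, (T + ∑ j, -(u i j * t j)) ^ x i =
      ∑ c ∈ ((Fintype.piFinset fun _ : Fin n =>
          Fintype.piFinset fun _ : Fin n => Finset.range (N + 1)).filter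
          fun c => ∑ i, ∑ j, c i j ≤ N),
        (∏ i, (ascPochhammer ℝ (∑ j, c i j)).eval (-(x i : ℝ))) *
          (∏ i, ∏ j, u i j ^ (c i j) / ((c i j).factorial : ℝ)) *
          (T ^ (N - ∑ i, ∑ j, c i j) * ∏ j, t j ^ ∑ i, c i j) := by
  have hxi : ∀ i, x i ≤ N := fun i =>
    (Finset.single_le_sum (fun i _ => Nat.zero_le _) (Finset.mem_univ i)).trans hx
  simp_rw [fun i => add_sum_pow_eq_sum_box (hxi i) T fun j => -(u i j * t j)]
  rw [Finset.prod_univ_sum, Finset.mul_sum, eq_comm]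
  have hzero : ∀ c : Fin n → Fin n → ℕ, (¬ ∀ i, ∑ j, c i j ≤ x i) →
      ∏ i, ((x i).descFactorial (∑ j, c i j) : ℝ) = 0 := by
    intro c hc
    push Not at hc
    obtain ⟨i, hi⟩ := hc
    exact Finset.prod_eq_zero (Finset.mem_univ i)
      (by simp [Nat.descFactorial_eq_zero_iff_lt.2 hi])
  refine Finset.sum_subset_zero_on_sdiff (Finset.filter_subset _ _) ?_ ?_
  · intro c hc
    rw [Finset.mem_sdiff, Finset.mem_filter, not_and] at hc
    have : ¬ ∀ i, ∑ j, c i j ≤ x i := fun h =>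
      hc.2 hc.1 ((Finset.sum_le_sum fun i _ => h i).trans hx)
    simp [Finset.prod_mul_distrib, hzero c this]
  · intro c _
    simp only [ascPochhammer_eval_neg_natCast, Finset.prod_mul_distrib]
    by_cases hc : ∀ i, ∑ j, c i j ≤ x i
    · have hT : T ^ (N - ∑ i, ∑ j, c i j) =
          T ^ (N - ∑ i, x i) * ∏ i, T ^ (x i - ∑ j, c i j) := by
        have h := Finset.sum_le_sum fun i (_ : i ∈ Finset.univ) => hc i
        rw [Finset.prod_pow_eq_pow_sum, ← pow_add, Finset.sum_tsub_distrib _ fun i _ => hc i]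
        congr 1
        omega
      have ht : ∏ j, t j ^ ∑ i, c i j = ∏ i, ∏ j, t j ^ c i j := by
        simp_rw [← Finset.prod_pow_eq_pow_sum]
        exact Finset.prod_comm
      have hneg : ∀ i j, (-(u i j * t j)) ^ c i j / ((c i j).factorial : ℝ) =
          (-1) ^ c i j * (u i j ^ c i j / ((c i j).factorial : ℝ)) * t j ^ c i j := by
        intro i j
        rw [neg_pow, mul_pow]
        ring
      rw [hT, ht]
      simp only [hneg, Finset.prod_mul_distrib, ← Finset.prod_pow_eq_pow_sum]
      ring
    · simp [hzero c hc]

theorem stmt8 (n N : ℕ) (hn : 0 < n) (hN : 0 < N)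
    (u : Matrix (Fin n) (Fin n) ℝ)
    (x : Fin n → ℕ) (hx : x ∈ XSet n N) (t : Fin n → ℝ) :
    (1 + ∑ j, t j) ^ (N - ∑ i, x i) *
        ∏ i, (1 + ∑ j, (1 - u i j) * t j) ^ (x i)
      = ∑ m ∈ XSet n N,
          ((N.factorial : ℝ) /
              (((∏ j, (m j).factorial) * (N - ∑ j, m j).factorial : ℕ) : ℝ)) *
            RahmanP n N u m x * ∏ j, t j ^ (m j) := by
  have hx' : ∑ i, x i ≤ N := (Finset.mem_filter.1 hx).2
  have hlin : ∀ i, 1 + ∑ j, (1 - u i j) * t j = (1 + ∑ j, t j) + ∑ j, -(u i j * t j) := by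
    intro i
    rw [add_assoc, ← Finset.sum_add_distrib]
    exact congrArg _ (Finset.sum_congr rfl fun j _ => by ring)
  simp_rw [hlin]
  rw [pow_mul_prod_pow_eq_sum u x hx']
  simp only [RahmanP, Finset.mul_sum, Finset.sum_mul]
  rw [Finset.sum_comm]
  refine Finset.sum_congr rfl fun c hc => ?_
  have hcol : ∑ i, ∑ j, c i j = ∑ j, ∑ i, c i j := Finset.sum_comm
  have hcN : ∑ j, ∑ i, c i j ≤ N := hcol ▸ (Finset.mem_filter.1 hc).2
  rw [hcol, ← sum_multinomial_mul_descFactorial (fun j => ∑ i, c i j) hcN t, Finset.mul_sum]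
  refine Finset.sum_congr rfl fun m _ => ?_
  have hsign : (∏ j, (ascPochhammer ℝ (∑ i, c i j)).eval (-(m j : ℝ))) /
      (ascPochhammer ℝ (∑ j, ∑ i, c i j)).eval (-(N : ℝ)) =
      (∏ j, ((m j).descFactorial (∑ i, c i j) : ℝ)) /
        (N.descFactorial (∑ j, ∑ i, c i j) : ℝ) := by
    simp only [ascPochhammer_eval_neg_natCast, Finset.prod_mul_distrib,
      Finset.prod_pow_eq_pow_sum]
    exact mul_div_mul_left _ _ (pow_ne_zero _ (by norm_num))
  rw [mul_div_assoc, hsign]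
  ring
end

section
/- First-moment summation formula for the type-(1) Markov chain: for every y ∈ X and every i ∈ {1,…,n}, Σ_{x ∈ X} x_i · K_n^{(1)}(x,y) = β_i N − β_i Σ_{j=1}^n α_j y_j + α_i y_i. -/
open Finset

theorem mem_XSet {n N : ℕ} {x : Fin n → ℕ} : x ∈ XSet n N ↔ ∑ i, x i ≤ N := by
  simp only [XSet, mem_filter, Fintype.mem_piFinset, mem_range, Nat.lt_succ_iff,
    and_iff_right_iff_imp]
  exact fun h i => (single_le_sum (fun _ _ => Nat.zero_le _) (mem_univ i)).trans h

theorem W1_eq_eval_bernstein (x y : ℕ) (a : ℝ) :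
    W1 x y a = (bernsteinPolynomial ℝ y x).eval a := by
  simp [W1, bernsteinPolynomial]

theorem sum_W1 (y : ℕ) (a : ℝ) : ∑ x ∈ range (y + 1), W1 x y a = 1 := by
  simpa [W1_eq_eval_bernstein, Polynomial.eval_finsetSum] using
    congrArg (Polynomial.eval a) (bernsteinPolynomial.sum ℝ y)

theorem sum_mul_W1 (y : ℕ) (a : ℝ) : ∑ x ∈ range (y + 1), (x : ℝ) * W1 x y a = a * y := by
  simpa [W1_eq_eval_bernstein, Polynomial.eval_finsetSum, mul_comm a] using
    congrArg (Polynomial.eval a) (bernsteinPolynomial.sum_smul ℝ y)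

theorem sum_prod_W1 {n : ℕ} (y : Fin n → ℕ) (α : Fin n → ℝ) :
    ∑ z ∈ Fintype.piFinset fun i => range (y i + 1), ∏ i, W1 (z i) (y i) (α i) = 1 := by
  rw [← prod_univ_sum (fun i => range (y i + 1)) fun i k => W1 k (y i) (α i)]
  simp [sum_W1]

theorem sum_mul_prod_W1 {n : ℕ} (y : Fin n → ℕ) (α : Fin n → ℝ) (j : Fin n) :
    ∑ z ∈ Fintype.piFinset fun i => range (y i + 1), (z j : ℝ) * ∏ i, W1 (z i) (y i) (α i)
      = α j * y j := by
  have key := prod_univ_sum (fun i => range (y i + 1))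
    fun i k => (if i = j then (k : ℝ) else 1) * W1 k (y i) (α i)
  simp only [prod_mul_distrib, prod_ite_eq', mem_univ, if_true] at key
  rw [← key, prod_eq_single j]
  · simp [sum_mul_W1]
  · intro i _ hi
    simp [hi, sum_W1]
  · simp

theorem sum_Wmult {n : ℕ} (M : ℕ) (β : Fin n → ℝ) : ∑ w ∈ XSet n M, Wmult w M β = 1 := by
  have key := sum_pow_eq_sum_piAntidiag univ (Fin.cons (1 - ∑ i, β i) β : Fin (n + 1) → ℝ) M
  rw [Fin.sum_univ_succ] at key
  simp only [Fin.cons_zero, Fin.cons_succ, sub_add_cancel, one_pow] at key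
  rw [key]
  refine sum_nbij' (fun w => (Fin.cons (M - ∑ i, w i) w : Fin (n + 1) → ℕ)) Fin.tail ?_ ?_ ?_ ?_ ?_
  · intro w hw
    rw [mem_XSet] at hw
    simp [mem_piAntidiag, Fin.sum_univ_succ, hw]
  · intro k hk
    simp only [mem_piAntidiag, Fin.sum_univ_succ] at hk
    simp only [mem_XSet, Fin.tail]
    omega
  · intro w _
    simp
  · intro k hk
    simp only [mem_piAntidiag, Fin.sum_univ_succ] at hk
    have h : M - ∑ i, Fin.tail k i = k 0 := by
      simp only [Fin.tail]
      omega
    rw [h, Fin.cons_self_tail]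
  · intro w hw
    rw [mem_XSet] at hw
    rw [Nat.multinomial, Nat.cast_div (Nat.prod_factorial_dvd_factorial_sum _ _)
      (by exact_mod_cast prod_ne_zero_iff.2 fun _ _ => Nat.factorial_ne_zero _)]
    simp only [Fin.sum_univ_succ, Fin.prod_univ_succ, Fin.cons_zero, Fin.cons_succ,
      Nat.sub_add_cancel hw, Wmult, mul_comm (M - ∑ i, w i).factorial]
    ring

theorem succ_mul_Wmult_add_single {n : ℕ} (M : ℕ) (β : Fin n → ℝ) (i : Fin n) (w : Fin n → ℕ) :
    ((w i + 1 : ℕ) : ℝ) * Wmult (w + Pi.single i 1) (M + 1) β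
      = (M + 1 : ℕ) * β i * Wmult w M β := by
  have hsum : ∑ j, (w + Pi.single i 1 : Fin n → ℕ) j = ∑ j, w j + 1 := by
    simp [sum_add_distrib]
  have hpow : ∏ j, β j ^ (w + Pi.single i 1 : Fin n → ℕ) j = β i * ∏ j, β j ^ w j := by
    simp only [Pi.add_apply, pow_add, prod_mul_distrib, mul_comm (β i)]
    congr 1
    rw [prod_eq_single i] <;> simp +contextual
  have hfact : ∏ j, ((w + Pi.single i 1 : Fin n → ℕ) j).factorial
      = (w i + 1) * ∏ j, (w j).factorial := by
    rw [← mul_prod_erase univ _ (mem_univ i), ← mul_prod_erase univ (fun j => (w j).factorial)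
      (mem_univ i), ← mul_assoc, ← Nat.factorial_succ]
    congr 1
    · simp
    · refine prod_congr rfl fun j hj => ?_
      simp [ne_of_mem_erase hj]
  have h0 : ((∏ j, (w j).factorial : ℕ) : ℝ) ≠ 0 := by
    exact_mod_cast prod_ne_zero_iff.2 fun _ _ => Nat.factorial_ne_zero _
  rw [Wmult, Wmult, hsum, hpow, hfact, Nat.add_sub_add_right, Nat.factorial_succ]
  push_cast at h0 ⊢
  field_simp

theorem sum_mul_Wmult {n : ℕ} (M : ℕ) (β : Fin n → ℝ) (i : Fin n) :
    ∑ w ∈ XSet n M, (w i : ℝ) * Wmult w M β = M * β i := by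
  cases M with
  | zero =>
    refine (sum_eq_zero fun w hw => ?_).trans (by simp)
    have : w i = 0 := by
      rw [mem_XSet, Nat.le_zero, sum_eq_zero_iff] at hw
      exact hw i (mem_univ i)
    simp [this]
  | succ M =>
    rw [← mul_one (_ * β i), ← sum_Wmult M β, mul_sum,
      ← sum_filter_of_ne (p := fun w => w i ≠ 0) (by intro w _ h h0; simp [h0] at h)]
    have hle : ∀ w : Fin n → ℕ, w i ≠ 0 → Pi.single i 1 ≤ w := by
      intro w hw j
      obtain rfl | hj := eq_or_ne j i
      · simpa using Nat.one_le_iff_ne_zero.2 hw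
      · simp [hj]
    symm
    refine sum_nbij' (fun w => w + Pi.single i 1) (fun w => w - Pi.single i 1) ?_ ?_ ?_ ?_ ?_
    · intro w hw
      rw [mem_XSet] at hw
      simpa [mem_XSet, sum_add_distrib] using hw
    · intro w hw
      rw [mem_filter, mem_XSet] at hw
      have := congrArg (fun v : Fin n → ℕ => ∑ j, v j) (tsub_add_cancel_of_le (hle w hw.2))
      simp only [Pi.add_apply, sum_add_distrib, sum_pi_single', mem_univ, if_true] at this
      rw [mem_XSet]
      omega
    · intro w _
      simp
    · intro w hw
      rw [mem_filter] at hw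
      exact tsub_add_cancel_of_le (hle w hw.2)
    · intro w _
      simpa using (succ_mul_Wmult_add_single M β i w).symm

/-- Substituting `x = z + w` in a sum against the type-(1) transition matrix. -/
theorem sum_mul_K1 {n N : ℕ} (α β : Fin n → ℝ) {y : Fin n → ℕ} (hy : y ∈ XSet n N)
    (f : (Fin n → ℕ) → ℝ) :
    ∑ x ∈ XSet n N, f x * K1 n N α β x y
      = ∑ z ∈ Fintype.piFinset fun i => range (y i + 1), (∏ i, W1 (z i) (y i) (α i)) *
          ∑ w ∈ XSet n (N - ∑ i, z i), f (z + w) * Wmult w (N - ∑ i, z i) β := by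
  simp only [K1, mul_sum, sum_sigma']
  refine sum_nbij' (fun p => ⟨p.2, p.1 - p.2⟩) (fun p => ⟨p.1 + p.2, p.1⟩) ?_ ?_ ?_ ?_ ?_
  · rintro ⟨x, z⟩ h
    simp only [mem_sigma, mem_XSet, Fintype.mem_piFinset, mem_range, Nat.lt_succ_iff,
      le_min_iff] at h ⊢
    have : ∑ i, (x i - z i + z i) = ∑ i, x i :=
      sum_congr rfl fun i _ => Nat.sub_add_cancel (h.2 i).1
    rw [sum_add_distrib] at this
    refine ⟨fun i => (h.2 i).2, ?_⟩
    simp only [Pi.sub_apply]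
    omega
  · rintro ⟨z, w⟩ h
    simp only [mem_sigma, mem_XSet, Fintype.mem_piFinset, mem_range, Nat.lt_succ_iff,
      le_min_iff] at h hy ⊢
    have := sum_le_sum fun i (_ : i ∈ univ) => h.1 i
    refine ⟨?_, fun i => ⟨by simp, h.1 i⟩⟩
    simp only [Pi.add_apply, sum_add_distrib]
    omega
  · rintro ⟨x, z⟩ h
    simp only [mem_sigma, Fintype.mem_piFinset, mem_range, Nat.lt_succ_iff, le_min_iff] at h
    have : z + (x - z) = x := add_tsub_cancel_of_le fun i => (h.2 i).1
    simp [this]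
  · rintro ⟨z, w⟩ _
    simp
  · rintro ⟨x, z⟩ h
    simp only [mem_sigma, Fintype.mem_piFinset, mem_range, Nat.lt_succ_iff, le_min_iff] at h
    have : z + (x - z) = x := add_tsub_cancel_of_le fun i => (h.2 i).1
    simp only [this]
    change f x * (Wmult (x - z) _ β * _) = _
    ring

theorem stmt10 (n N : ℕ) (hn : 0 < n) (hN : 0 < N) (α β : Fin n → ℝ)
    (hα : ∀ i, 0 < α i ∧ α i < 1) (hβ : ∀ i, 0 < β i) (hβs : ∑ i, β i < 1)
    (y : Fin n → ℕ) (hy : y ∈ XSet n N) (i : Fin n) :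
    ∑ x ∈ XSet n N, (x i : ℝ) * K1 n N α β x y
      = β i * N - β i * (∑ j, α j * (y j : ℝ)) + α i * (y i : ℝ) := by
  rw [sum_mul_K1 α β hy fun x => (x i : ℝ)]
  have hmean : ∀ z ∈ Fintype.piFinset fun i => range (y i + 1),
      (∏ i, W1 (z i) (y i) (α i)) * ∑ w ∈ XSet n (N - ∑ i, z i),
        (((z + w) i : ℕ) : ℝ) * Wmult w (N - ∑ i, z i) β
      = β i * N * (∏ i, W1 (z i) (y i) (α i))
        - β i * ∑ j, (z j : ℝ) * ∏ i, W1 (z i) (y i) (α i)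
        + z i * ∏ i, W1 (z i) (y i) (α i) := by
    intro z hz
    simp only [Fintype.mem_piFinset, mem_range, Nat.lt_succ_iff] at hz
    have hle : ∑ j, z j ≤ N := (sum_le_sum fun j _ => hz j).trans (mem_XSet.1 hy)
    simp only [Pi.add_apply, Nat.cast_add, add_mul, sum_add_distrib, ← mul_sum, sum_Wmult,
      sum_mul_Wmult, ← sum_mul, Nat.cast_sub hle, Nat.cast_sum]
    ring
  rw [sum_congr rfl hmean, sum_add_distrib, sum_sub_distrib, ← mul_sum, ← mul_sum, sum_comm]
  simp only [sum_prod_W1, sum_mul_prod_W1, mul_one]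
end

section
/- The Rahman polynomials are left eigenvectors of the type-(1) Markov chain with multiplicative spectrum: suppose λ_1,…,λ_n ∈ ℝ satisfy λ_j ≠ α_i for all i,j and the sum rules Σ_{i=1}^n α_i β_i/(λ_j − α_i) = −1 for each j = 1,…,n, and set u_{ij} = α_i(λ_j − 1)/(λ_j − α_i). Then for every m ∈ X and every y ∈ X, Σ_{x ∈ X} K_n^{(1)}(x,y) P_m(x;u) = (∏_{j=1}^n λ_j^{m_j}) · P_m(y;u). -/
open Finset

theorem XSet_mono {n M N : ℕ} (h : M ≤ N) : XSet n M ⊆ XSet n N := fun _ hx =>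
  mem_XSet.2 ((mem_XSet.1 hx).trans h)

theorem sum_XSet_shift {n N : ℕ} (z : Fin n → ℕ) (hz : ∑ i, z i ≤ N) (f : (Fin n → ℕ) → ℝ) :
    ∑ x ∈ XSet n N with ∀ i, z i ≤ x i, f x = ∑ w ∈ XSet n (N - ∑ i, z i), f (w + z) := by
  symm
  refine sum_bij' (fun w _ => w + z) (fun x _ => x - z) ?_ ?_ ?_ ?_ ?_
  · intro w hw
    have := mem_XSet.1 hw
    simp only [mem_filter, mem_XSet, Pi.add_apply, sum_add_distrib]
    exact ⟨by omega, fun i => Nat.le_add_left _ _⟩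
  · intro x hx
    simp only [mem_filter, mem_XSet] at hx
    have h : ∑ i, (x - z) i + ∑ i, z i = ∑ i, x i := by
      rw [← sum_add_distrib]
      exact sum_congr rfl fun i _ => Nat.sub_add_cancel (hx.2 i)
    rw [mem_XSet]
    omega
  · intro w _
    exact add_tsub_cancel_right w z
  · intro x hx
    exact tsub_add_cancel_of_le (mem_filter.1 hx).2
  · intro w _
    rfl

theorem add_sum_pow_eq_sum_XSet {n M : ℕ} (a₀ : ℝ) (a : Fin n → ℝ) :
    (a₀ + ∑ i, a i) ^ M = ∑ x ∈ XSet n M,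
      (M.descFactorial (∑ i, x i) : ℝ) * a₀ ^ (M - ∑ i, x i) *
        ∏ i, (a i ^ x i / ((x i).factorial : ℝ)) := by
  rw [add_comm, add_pow, ← sum_fiberwise_of_maps_to (s := XSet n M) (t := range (M + 1))
    (g := fun x => ∑ i, x i) (fun x hx => mem_range.2 (Nat.lt_succ_of_le (mem_XSet.1 hx)))]
  refine sum_congr rfl fun k hk => ?_
  have hset : (XSet n M).filter (fun x => ∑ i, x i = k) = piAntidiag univ k := by
    ext x
    have := mem_range.1 hk
    simp only [mem_filter, mem_XSet, mem_piAntidiag, mem_univ, implies_true, and_true]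
    exact ⟨And.right, fun h => ⟨h.trans_le (Nat.lt_succ_iff.1 this), h⟩⟩
  rw [hset, sum_pow_eq_sum_piAntidiag, sum_mul, sum_mul]
  refine sum_congr rfl fun x hx => ?_
  have hx : ∑ i, x i = k := (mem_piAntidiag.1 hx).1
  have hm : (∏ i, ((x i).factorial : ℝ)) * (Nat.multinomial univ x : ℝ) = (k.factorial : ℝ) := by
    rw [← hx]
    exact_mod_cast Nat.multinomial_spec univ x
  have hne : (∏ i, ((x i).factorial : ℝ)) ≠ 0 :=
    prod_ne_zero_iff.2 fun i _ => Nat.cast_ne_zero.2 (Nat.factorial_ne_zero _)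
  rw [hx, prod_div_distrib, Nat.descFactorial_eq_factorial_mul_choose, Nat.cast_mul, ← hm]
  field_simp

theorem add_sum_pow_eq_sum_XSet_of_le {n M N : ℕ} (h : M ≤ N) (a₀ : ℝ) (a : Fin n → ℝ) :
    (a₀ + ∑ i, a i) ^ M = ∑ x ∈ XSet n N,
      (M.descFactorial (∑ i, x i) : ℝ) * a₀ ^ (M - ∑ i, x i) *
        ∏ i, (a i ^ x i / ((x i).factorial : ℝ)) := by
  rw [add_sum_pow_eq_sum_XSet]
  refine sum_subset (XSet_mono h) fun x _ hx => ?_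
  rw [mem_XSet, not_le] at hx
  rw [Nat.descFactorial_of_lt hx, Nat.cast_zero, zero_mul, zero_mul]

theorem Wmult_eq {n M : ℕ} {x : Fin n → ℕ} (hx : ∑ i, x i ≤ M) (β : Fin n → ℝ) :
    Wmult x M β = (M.descFactorial (∑ i, x i) : ℝ) * (1 - ∑ i, β i) ^ (M - ∑ i, x i) *
      ∏ i, (β i ^ x i / ((x i).factorial : ℝ)) := by
  have h1 : ((M - ∑ i, x i).factorial : ℝ) ≠ 0 := Nat.cast_ne_zero.2 (Nat.factorial_ne_zero _)
  have hne : (∏ i, ((x i).factorial : ℝ)) ≠ 0 :=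
    prod_ne_zero_iff.2 fun i _ => Nat.cast_ne_zero.2 (Nat.factorial_ne_zero _)
  rw [Wmult, prod_div_distrib, ← Nat.factorial_mul_descFactorial hx]
  push_cast
  field_simp

theorem sum_Wmult_mul {n M : ℕ} (β : Fin n → ℝ) (a₀ : ℝ) (a : Fin n → ℝ) :
    ∑ w ∈ XSet n M, Wmult w M β * (a₀ ^ (M - ∑ i, w i) * ∏ i, a i ^ w i) =
      ((1 - ∑ i, β i) * a₀ + ∑ i, β i * a i) ^ M := by
  rw [add_sum_pow_eq_sum_XSet]
  refine sum_congr rfl fun w hw => ?_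
  rw [Wmult_eq (mem_XSet.1 hw), mul_pow]
  simp only [mul_pow, mul_div_right_comm, prod_mul_distrib]
  ring

/-- The generating function of the `x`-distribution of the type-(1) chain started at `y`. -/
theorem sum_K1_mul {n N : ℕ} (α β : Fin n → ℝ) (a₀ : ℝ) (a : Fin n → ℝ) {y : Fin n → ℕ}
    (hy : y ∈ XSet n N) {B : ℝ} (hB : (1 - ∑ i, β i) * a₀ + ∑ i, β i * a i = B) :
    ∑ x ∈ XSet n N, K1 n N α β x y * (a₀ ^ (N - ∑ i, x i) * ∏ i, a i ^ x i) =
      B ^ (N - ∑ i, y i) * ∏ i, (α i * a i + (1 - α i) * B) ^ y i := by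
  have hy' := mem_XSet.1 hy
  have hswap : ∑ x ∈ XSet n N, K1 n N α β x y * (a₀ ^ (N - ∑ i, x i) * ∏ i, a i ^ x i) =
      ∑ z ∈ Fintype.piFinset fun i => range (y i + 1), ∑ x ∈ XSet n N with ∀ i, z i ≤ x i,
        Wmult (fun i => x i - z i) (N - ∑ i, z i) β * (∏ i, W1 (z i) (y i) (α i)) *
          (a₀ ^ (N - ∑ i, x i) * ∏ i, a i ^ x i) := by
    simp only [K1, sum_mul]
    refine sum_comm' fun x z => ?_
    simp only [Fintype.mem_piFinset, mem_range, Nat.lt_succ_iff, le_min_iff, mem_filter,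
      forall_and]
    tauto
  rw [hswap]
  simp only [add_pow]
  rw [prod_univ_sum, mul_sum]
  refine sum_congr rfl fun z hz => ?_
  have hzy : ∀ i, z i ≤ y i := fun i =>
    Nat.lt_succ_iff.1 (mem_range.1 (Fintype.mem_piFinset.1 hz i))
  have hzs : ∑ i, z i ≤ ∑ i, y i := sum_le_sum fun i _ => hzy i
  rw [sum_XSet_shift z (hzs.trans hy')]
  have hinner : ∀ w : Fin n → ℕ,
      Wmult (fun i => (w + z) i - z i) (N - ∑ i, z i) β * (∏ i, W1 (z i) (y i) (α i)) *
          (a₀ ^ (N - ∑ i, (w + z) i) * ∏ i, a i ^ (w + z) i) =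
      ((∏ i, W1 (z i) (y i) (α i)) * ∏ i, a i ^ z i) *
        (Wmult w (N - ∑ i, z i) β * (a₀ ^ (N - ∑ i, z i - ∑ i, w i) * ∏ i, a i ^ w i)) := by
    intro w
    have h1 : (fun i => (w + z) i - z i) = w := by
      ext i
      simp
    have h2 : N - ∑ i, (w + z) i = N - ∑ i, z i - ∑ i, w i := by
      simp only [Pi.add_apply, sum_add_distrib]
      omega
    rw [h1, h2]
    simp only [Pi.add_apply, pow_add, prod_mul_distrib]
    ring
  rw [sum_congr rfl fun w _ => hinner w, ← mul_sum, sum_Wmult_mul, hB]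
  have hpow : B ^ (N - ∑ i, z i) = B ^ (N - ∑ i, y i) * ∏ i, B ^ (y i - z i) := by
    rw [prod_pow_eq_pow_sum, ← pow_add, sum_tsub_distrib _ fun i _ => hzy i]
    congr 1
    omega
  rw [hpow]
  simp only [W1, mul_pow, prod_mul_distrib]
  ring

theorem pow_mul_prod_pow_eq_sum_XSet {n N : ℕ} (t : Fin n → ℝ) (d : Fin n → ℕ)
    (hd : ∑ j, d j ≤ N) :
    (1 + ∑ j, t j) ^ (N - ∑ j, d j) * ∏ j, t j ^ d j = ∑ m ∈ XSet n N,
      ((N.descFactorial (∑ j, m j) : ℝ) / ∏ j, ((m j).factorial : ℝ)) *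
        ((∏ j, ((m j).descFactorial (d j) : ℝ)) / (N.descFactorial (∑ j, d j) : ℝ)) *
          ∏ j, t j ^ m j := by
  rw [← sum_filter_of_ne (p := fun m : Fin n → ℕ => ∀ j, d j ≤ m j), sum_XSet_shift d hd, add_sum_pow_eq_sum_XSet,
    sum_mul]
  · refine sum_congr rfl fun e _ => ?_
    have hN : (N.descFactorial (∑ j, d j) : ℝ) ≠ 0 :=
      Nat.cast_ne_zero.2 fun h => (Nat.descFactorial_eq_zero_iff_lt.1 h).not_ge hd
    have h1 : (N.descFactorial (∑ j, (e + d) j) : ℝ) =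
        ((N - ∑ j, d j).descFactorial (∑ j, e j) : ℝ) * (N.descFactorial (∑ j, d j) : ℝ) := by
      have := Nat.descFactorial_mul_descFactorial (n := N) (k := ∑ j, d j)
        (m := ∑ j, (e + d) j) (sum_le_sum fun j _ => by simp)
      simp only [Pi.add_apply, sum_add_distrib, Nat.add_sub_cancel] at this ⊢
      exact_mod_cast this.symm
    have h2 : ∏ j, (((e + d) j).factorial : ℝ) =
        (∏ j, ((e j).factorial : ℝ)) * ∏ j, (((e + d) j).descFactorial (d j) : ℝ) := by
      rw [← prod_mul_distrib]
      refine prod_congr rfl fun j _ => ?_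
      have := Nat.factorial_mul_descFactorial (n := (e + d) j) (k := d j) (by simp)
      rw [← this]
      simp
    have h3 : (∏ j, (((e + d) j).descFactorial (d j) : ℝ)) ≠ 0 :=
      prod_ne_zero_iff.2 fun j _ => Nat.cast_ne_zero.2 fun h =>
        (Nat.descFactorial_eq_zero_iff_lt.1 h).not_ge (by simp)
    have h4 : (∏ j, ((e j).factorial : ℝ)) ≠ 0 :=
      prod_ne_zero_iff.2 fun i _ => Nat.cast_ne_zero.2 (Nat.factorial_ne_zero _)
    rw [h1, h2, one_pow, prod_div_distrib]
    simp only [Pi.add_apply, pow_add, prod_mul_distrib]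
    simp only [Pi.add_apply] at h3
    field_simp
  · intro m _ h j
    by_contra hj
    refine h ?_
    rw [prod_eq_zero (f := fun j => ((m j).descFactorial (d j) : ℝ)) (mem_univ j)]
    · simp
    · exact Nat.cast_eq_zero.2 (Nat.descFactorial_of_lt (not_le.1 hj))

theorem eval_ascPochhammer_neg_natCast (M k : ℕ) :
    (ascPochhammer ℝ k).eval (-(M : ℝ)) = (-1) ^ k * (M.descFactorial k : ℝ) := by
  rw [ascPochhammer_eval_neg_eq_descPochhammer, descPochhammer_eval_eq_descFactorial]

theorem RahmanP_eq (n N : ℕ) (u : Matrix (Fin n) (Fin n) ℝ) (m x : Fin n → ℕ) :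
    RahmanP n N u m x =
      ∑ c ∈ ((Fintype.piFinset fun _ : Fin n =>
          Fintype.piFinset fun _ : Fin n => Finset.range (N + 1)).filter
          fun c => ∑ i, ∑ j, c i j ≤ N),
        (∏ i, ((x i).descFactorial (∑ j, c i j) : ℝ)) *
          ((∏ j, ((m j).descFactorial (∑ i, c i j) : ℝ)) /
            (N.descFactorial (∑ i, ∑ j, c i j) : ℝ)) *
          ∏ i, ∏ j, (-u i j) ^ c i j / ((c i j).factorial : ℝ) := by
  rw [RahmanP]
  refine sum_congr rfl fun c _ => ?_
  have hs : ∏ i, ∏ j, (-u i j) ^ c i j / ((c i j).factorial : ℝ) =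
      (-1) ^ (∑ i, ∑ j, c i j) * ∏ i, ∏ j, u i j ^ c i j / ((c i j).factorial : ℝ) := by
    simp only [← prod_pow_eq_pow_sum, ← prod_mul_distrib]
    refine prod_congr rfl fun i _ => prod_congr rfl fun j _ => ?_
    rw [neg_pow, mul_div_assoc]
  have hsq : ((-1 : ℝ) ^ (∑ i, ∑ j, c i j)) * (-1) ^ (∑ i, ∑ j, c i j) = 1 := by
    rw [← mul_pow]
    simp
  simp only [eval_ascPochhammer_neg_natCast, prod_mul_distrib, prod_pow_eq_pow_sum]
  rw [hs, sum_comm (f := fun j i => c i j)]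
  generalize (-1 : ℝ) ^ (∑ i, ∑ j, c i j) = s at hsq ⊢
  obtain rfl | rfl := mul_self_eq_one_iff.1 hsq <;> ring

/-- The generating function of the Rahman polynomials in the spectral index `m`. -/
theorem sum_RahmanP_mul {n N : ℕ} (u : Matrix (Fin n) (Fin n) ℝ) (t : Fin n → ℝ)
    {x : Fin n → ℕ} (hx : x ∈ XSet n N) :
    ∑ m ∈ XSet n N, ((N.descFactorial (∑ j, m j) : ℝ) / ∏ j, ((m j).factorial : ℝ)) *
        RahmanP n N u m x * ∏ j, t j ^ m j =
      (1 + ∑ j, t j) ^ (N - ∑ i, x i) * ∏ i, (1 + ∑ j, (1 - u i j) * t j) ^ x i := by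
  have hx' := mem_XSet.1 hx
  set A := 1 + ∑ j, t j with hA
  have hfac : ∀ i, 1 + ∑ j, (1 - u i j) * t j = A + ∑ j, -u i j * t j := fun i => by
    rw [hA, add_assoc, ← sum_add_distrib]
    congr 1
    exact sum_congr rfl fun j _ => by ring
  have hxN : ∀ i, x i ≤ N := fun i =>
    (single_le_sum (fun j _ => Nat.zero_le (x j)) (mem_univ i)).trans hx'
  simp only [hfac, fun i => add_sum_pow_eq_sum_XSet_of_le (hxN i) A fun j => -u i j * t j]
  rw [prod_univ_sum]
  have hsub : ((Fintype.piFinset fun _ : Fin n =>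
      Fintype.piFinset fun _ : Fin n => Finset.range (N + 1)).filter
        fun c => ∑ i, ∑ j, c i j ≤ N) ⊆ Fintype.piFinset fun _ => XSet n N := by
    intro c hc
    refine Fintype.mem_piFinset.2 fun i => mem_XSet.2 ?_
    exact (single_le_sum (f := fun i => ∑ j, c i j) (fun _ _ => Nat.zero_le _)
      (mem_univ i)).trans (mem_filter.1 hc).2
  rw [← sum_subset hsub]
  · simp only [RahmanP_eq, mul_sum, sum_mul]
    rw [sum_comm]
    refine sum_congr rfl fun c hc => ?_
    have hcN : ∑ i, ∑ j, c i j ≤ N := (mem_filter.1 hc).2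
    have hcol : ∑ j, ∑ i, c i j = ∑ i, ∑ j, c i j := sum_comm
    have key := pow_mul_prod_pow_eq_sum_XSet t (fun j => ∑ i, c i j) (N := N) (by rwa [hcol])
    rw [hcol, ← hA] at key
    by_cases hle : ∀ i, ∑ j, c i j ≤ x i
    · have hpow : A ^ (N - ∑ i, ∑ j, c i j) =
          A ^ (N - ∑ i, x i) * ∏ i, A ^ (x i - ∑ j, c i j) := by
        have : ∑ i, ∑ j, c i j ≤ ∑ i, x i := sum_le_sum fun i _ => hle i
        rw [prod_pow_eq_pow_sum, ← pow_add, sum_tsub_distrib _ fun i _ => hle i]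
        congr 1
        omega
      have ht : ∏ j, t j ^ ∑ i, c i j = ∏ i, ∏ j, t j ^ c i j := by
        rw [prod_comm]
        exact prod_congr rfl fun j _ => (prod_pow_eq_pow_sum _ _ _).symm
      rw [hpow, ht] at key
      simp only [mul_pow, mul_div_right_comm, prod_mul_distrib]
      calc _ = (∏ i, ((x i).descFactorial (∑ j, c i j) : ℝ)) *
            (∏ i, ∏ j, (-u i j) ^ c i j / ((c i j).factorial : ℝ)) * ∑ m ∈ XSet n N,
            ((N.descFactorial (∑ j, m j) : ℝ) / ∏ j, ((m j).factorial : ℝ)) *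
            ((∏ j, ((m j).descFactorial (∑ i, c i j) : ℝ)) /
              (N.descFactorial (∑ i, ∑ j, c i j) : ℝ)) * ∏ j, t j ^ m j := by
            rw [mul_sum]
            exact sum_congr rfl fun m _ => by ring
        _ = _ := by
            rw [← key]
            ring
    · push Not at hle
      obtain ⟨i, hi⟩ := hle
      have h0 : ((x i).descFactorial (∑ j, c i j) : ℝ) = 0 :=
        Nat.cast_eq_zero.2 (Nat.descFactorial_of_lt hi)
      have h1 : ∏ i, ((x i).descFactorial (∑ j, c i j) : ℝ) = 0 := prod_eq_zero (mem_univ i) h0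
      simp [h1, prod_mul_distrib]
  · intro c hc hc'
    have hN : N < ∑ i, ∑ j, c i j := by
      by_contra hN
      refine hc' (mem_filter.2 ⟨Fintype.mem_piFinset.2 fun i => ?_, not_lt.1 hN⟩)
      exact (mem_filter.1 (Fintype.mem_piFinset.1 hc i)).1
    obtain ⟨i, -, hi⟩ := exists_lt_of_sum_lt (hx'.trans_lt hN)
    refine prod_eq_zero (mem_univ i) ?_
    rw [Nat.descFactorial_of_lt hi, Nat.cast_zero, zero_mul, zero_mul]

theorem coeff_eq_of_forall_sum_XSet_eq {n N : ℕ} {a b : (Fin n → ℕ) → ℝ}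
    (h : ∀ t : Fin n → ℝ, ∑ m ∈ XSet n N, a m * ∏ j, t j ^ m j =
      ∑ m ∈ XSet n N, b m * ∏ j, t j ^ m j) {m : Fin n → ℕ} (hm : m ∈ XSet n N) :
    a m = b m := by
  have hp : ∑ m ∈ XSet n N, MvPolynomial.monomial (Finsupp.equivFunOnFinite.symm m) (a m) =
      ∑ m ∈ XSet n N, MvPolynomial.monomial (Finsupp.equivFunOnFinite.symm m) (b m) := by
    refine MvPolynomial.funext fun t => ?_
    simpa [MvPolynomial.eval_monomial, Finsupp.prod_fintype] using h t
  have hc := congrArg (MvPolynomial.coeff (Finsupp.equivFunOnFinite.symm m)) hp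
  simpa [MvPolynomial.coeff_sum, MvPolynomial.coeff_monomial, hm] using hc

theorem stmt18 (n N : ℕ) (hn : 0 < n) (hN : 0 < N) (α β : Fin n → ℝ)
    (hα : ∀ i, 0 < α i ∧ α i < 1) (hβ : ∀ i, 0 < β i) (hβs : ∑ i, β i < 1)
    (lam : Fin n → ℝ) (hne : ∀ i j, lam j ≠ α i)
    (hsum : ∀ j, ∑ i, α i * β i / (lam j - α i) = -1)
    (u : Matrix (Fin n) (Fin n) ℝ)
    (hu : ∀ i j, u i j = α i * (lam j - 1) / (lam j - α i))
    (m : Fin n → ℕ) (hm : m ∈ XSet n N)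
    (y : Fin n → ℕ) (hy : y ∈ XSet n N) :
    ∑ x ∈ XSet n N, K1 n N α β x y * RahmanP n N u m x
      = (∏ j, lam j ^ (m j)) * RahmanP n N u m y := by
  have hβu : ∀ j, ∑ i, β i * u i j = 1 - lam j := fun j => by
    have : ∑ i, β i * u i j = (lam j - 1) * ∑ i, α i * β i / (lam j - α i) := by
      rw [mul_sum]
      exact sum_congr rfl fun i _ => by rw [hu]; ring
    rw [this, hsum]
    ring
  have hαu : ∀ i j, α i * (1 - u i j) + (1 - α i) * lam j = (1 - u i j) * lam j := fun i j => by
    have := sub_ne_zero.2 (hne i j)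
    rw [hu]
    field_simp
    ring
  set w : (Fin n → ℕ) → ℝ := fun m =>
    (N.descFactorial (∑ j, m j) : ℝ) / ∏ j, ((m j).factorial : ℝ) with hw
  have hwm : w m ≠ 0 := div_ne_zero
    (Nat.cast_ne_zero.2 fun h => (Nat.descFactorial_eq_zero_iff_lt.1 h).not_ge (mem_XSet.1 hm))
    (prod_ne_zero_iff.2 fun i _ => Nat.cast_ne_zero.2 (Nat.factorial_ne_zero _))
  refine mul_left_cancel₀ hwm ?_
  refine coeff_eq_of_forall_sum_XSet_eq (N := N)
    (a := fun m => w m * ∑ x ∈ XSet n N, K1 n N α β x y * RahmanP n N u m x)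
    (b := fun m => w m * ((∏ j, lam j ^ (m j)) * RahmanP n N u m y)) (fun t => ?_) hm
  have hB : (1 - ∑ i, β i) * (1 + ∑ j, t j) + ∑ i, β i * (1 + ∑ j, (1 - u i j) * t j) =
      1 + ∑ j, lam j * t j := by
    have h1 : ∑ i, β i * (1 + ∑ j, (1 - u i j) * t j) =
        ∑ i, β i * (1 + ∑ j, t j) - ∑ j, (∑ i, β i * u i j) * t j := by
      simp only [sum_mul]
      rw [sum_comm (f := fun j i => β i * u i j * t j), ← sum_sub_distrib]
      refine sum_congr rfl fun i _ => ?_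
      simp only [sub_mul, one_mul, sum_sub_distrib, mul_assoc, ← mul_sum]
      ring
    rw [h1, ← sum_mul]
    simp only [hβu, sub_mul, one_mul, sum_sub_distrib]
    ring
  calc ∑ m ∈ XSet n N, w m * (∑ x ∈ XSet n N, K1 n N α β x y * RahmanP n N u m x) *
        ∏ j, t j ^ m j
      = ∑ x ∈ XSet n N, K1 n N α β x y *
          ∑ m ∈ XSet n N, w m * RahmanP n N u m x * ∏ j, t j ^ m j := by
        simp only [mul_sum, sum_mul]
        rw [sum_comm]
        exact sum_congr rfl fun x _ => sum_congr rfl fun m _ => by ring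
    _ = ∑ x ∈ XSet n N, K1 n N α β x y * ((1 + ∑ j, t j) ^ (N - ∑ i, x i) *
          ∏ i, (1 + ∑ j, (1 - u i j) * t j) ^ x i) :=
        sum_congr rfl fun x hx => by rw [sum_RahmanP_mul u t hx]
    _ = (1 + ∑ j, lam j * t j) ^ (N - ∑ i, y i) *
          ∏ i, (1 + ∑ j, (1 - u i j) * (lam j * t j)) ^ y i := by
        rw [sum_K1_mul α β _ _ hy hB]
        congr 1
        refine prod_congr rfl fun i _ => ?_
        congr 1
        simp only [← mul_assoc, ← hαu, add_mul, mul_add, mul_sum, sum_add_distrib]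
        ring
    _ = ∑ m ∈ XSet n N, w m * RahmanP n N u m y * ∏ j, (lam j * t j) ^ m j :=
        (sum_RahmanP_mul u _ hy).symm
    _ = _ := sum_congr rfl fun m _ => by
        simp only [mul_pow, prod_mul_distrib]
        ring
end
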